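/- Let s, t ≥ 2 and set m₁ = 2s+1, m₂ = 2t+1. Then there is NO 4×(m₁+m₂) integer matrix Λ with columns λ₁,…,λ_{m₁+m₂} ∈ ℤ⁴ such that: (i) λ₁ = e₁, λ₂ = e₂, λ_{m₁+1} = e₃, λ_{m₁+2} = e₄; (ii) det(λ_i, λ_{i+1}, λ_{m₁+j}, λ_{m₁+j+1}) ∈ {1,−1} for every i and j, where the index i runs cyclically through {1,…,m₁} and the index m₁+j runs cyclically through {m₁+1,…,m₁+m₂}; and (iii) every column sum λ_{1,j} + λ_{2,j} + λ_{3,j} + λ_{4,j} is odd. (This is the key step showing that a product of two odd-gons C₂(m₁)×C₂(m₂) with m₁, m₂ ≥ 5 odd is not the orbit polytope of any spin, hence of any string, quasitoric manifold.) -/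

import Mathlib

open Finset

/-- Every two-colouring of the Fano plane has a monochromatic line. -/
theorem fano_exists_monochromatic_line (P : (Fin 3 → ZMod 2) → Prop) :
    ∃ x y : Fin 3 → ZMod 2, x ≠ 0 ∧ y ≠ 0 ∧ x ≠ y ∧
      ((P x ∧ P y ∧ P (x + y)) ∨ (¬ P x ∧ ¬ P y ∧ ¬ P (x + y))) := by
  by_contra h
  have key : ∀ x y z : Fin 3 → ZMod 2, x ≠ 0 → y ≠ 0 → x ≠ y → x + y = z →
      ¬ ((P x ∧ P y ∧ P z) ∨ (¬ P x ∧ ¬ P y ∧ ¬ P z)) := by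
    rintro x y z hx hy hxy rfl hP
    exact h ⟨x, y, hx, hy, hxy, hP⟩
  have h₁ := key ![1, 0, 0] ![0, 1, 0] ![1, 1, 0] (by decide) (by decide) (by decide) (by decide)
  have h₂ := key ![1, 0, 0] ![0, 0, 1] ![1, 0, 1] (by decide) (by decide) (by decide) (by decide)
  have h₃ := key ![0, 1, 0] ![0, 0, 1] ![0, 1, 1] (by decide) (by decide) (by decide) (by decide)
  have h₄ := key ![1, 0, 0] ![0, 1, 1] ![1, 1, 1] (by decide) (by decide) (by decide) (by decide)
  have h₅ := key ![0, 1, 0] ![1, 0, 1] ![1, 1, 1] (by decide) (by decide) (by decide) (by decide)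
  have h₆ := key ![0, 0, 1] ![1, 1, 0] ![1, 1, 1] (by decide) (by decide) (by decide) (by decide)
  have h₇ := key ![1, 1, 0] ![1, 0, 1] ![0, 1, 1] (by decide) (by decide) (by decide) (by decide)
  clear key h
  grind only

/-- The complement of a line of the Fano plane is an affine hyperplane avoiding the origin. -/
theorem fano_exists_functional_of_line :
    ∀ x y : Fin 3 → ZMod 2, x ≠ 0 → y ≠ 0 → x ≠ y → ∃ f : Fin 3 → ZMod 2,
      ∀ v, v ≠ 0 → v ≠ x → v ≠ y → v ≠ x + y → f ⬝ᵥ v = 1 := by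
  decide +kernel

/-- A closed walk of odd length in `𝔽₂³` has no linear functional equal to `1` on all its steps. -/
theorem exists_dotProduct_step_ne_one (n : ℕ) (a : ZMod (2 * n + 1) → Fin 3 → ZMod 2)
    (f : Fin 3 → ZMod 2) : ∃ i, f ⬝ᵥ (a i + a (i + 1)) ≠ 1 := by
  by_contra! h
  have h_sum : ∑ i, f ⬝ᵥ (a i + a (i + 1)) = 0 := by
    simp_rw [dotProduct_add, Finset.sum_add_distrib]
    have h_shift : ∑ i, f ⬝ᵥ a (i + 1) = ∑ i, f ⬝ᵥ a i :=
      Equiv.sum_comp (Equiv.addRight (1 : ZMod (2 * n + 1))) fun i => f ⬝ᵥ a i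
    rw [h_shift]
    exact CharTwo.add_self_eq_zero _
  have h_two : (2 : ZMod 2) = 0 := rfl
  simp [h, h_two] at h_sum

/-- Two closed walks of odd length in `𝔽₂³` without stationary steps share a step. -/
theorem exists_common_step (s t : ℕ) (a : ZMod (2 * s + 1) → Fin 3 → ZMod 2)
    (b : ZMod (2 * t + 1) → Fin 3 → ZMod 2) (ha : ∀ i, a i + a (i + 1) ≠ 0)
    (hb : ∀ j, b j + b (j + 1) ≠ 0) : ∃ i j, a i + a (i + 1) = b j + b (j + 1) := by
  by_contra! h
  obtain ⟨x, y, hx, hy, hxy, hP⟩ :=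
    fano_exists_monochromatic_line fun v => ∃ i, a i + a (i + 1) = v
  obtain ⟨f, hf⟩ := fano_exists_functional_of_line x y hx hy hxy
  rcases hP with ⟨⟨i, hi⟩, ⟨j, hj⟩, k, hk⟩ | ⟨h₁, h₂, h₃⟩
  · obtain ⟨l, hl⟩ := exists_dotProduct_step_ne_one t b f
    exact hl (hf _ (hb l) (hi ▸ (h i l).symm) (hj ▸ (h j l).symm) (hk ▸ (h k l).symm))
  · obtain ⟨l, hl⟩ := exists_dotProduct_step_ne_one s a f
    exact hl (hf _ (ha l) (fun e => h₁ ⟨l, e⟩) (fun e => h₂ ⟨l, e⟩) (fun e => h₃ ⟨l, e⟩))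

/-- If the columns of a matrix of determinant `±1` have odd sums, then modulo `2` and on the first
three coordinates the sum of the first two columns and the sum of the last two columns are
nonzero and distinct. -/
theorem column_sums_of_det_eq_one_or_neg_one (p q u v : Fin 4 → ℤ)
    (h_det : (Matrix.of fun r c : Fin 4 => ![p r, q r, u r, v r] c).det = 1 ∨
      (Matrix.of fun r c : Fin 4 => ![p r, q r, u r, v r] c).det = -1)
    (hp : Odd (p 0 + p 1 + p 2 + p 3)) (hq : Odd (q 0 + q 1 + q 2 + q 3))
    (hu : Odd (u 0 + u 1 + u 2 + u 3)) (hv : Odd (v 0 + v 1 + v 2 + v 3)) :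
    let red : (Fin 4 → ℤ) → Fin 3 → ZMod 2 := fun w k => (w k.castSucc : ZMod 2)
    red p + red q ≠ 0 ∧ red u + red v ≠ 0 ∧ red p + red q ≠ red u + red v := by
  intro red
  have h_unit : IsUnit (Matrix.of fun r c : Fin 4 => ![p r, q r, u r, v r] c).det := by
    rcases h_det with h | h <;> simp [h]
  have h_ker : ∀ x : Fin 4 → ZMod 2, x ≠ 0 → ∃ r : Fin 4,
      (p r : ZMod 2) * x 0 + q r * x 1 + u r * x 2 + v r * x 3 ≠ 0 := by
    intro x hx
    by_contra! h
    have h_unit' := h_unit.map (Int.castRingHom (ZMod 2))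
    rw [RingHom.map_det] at h_unit'
    refine hx (Matrix.eq_zero_of_mulVec_eq_zero h_unit'.ne_zero ?_)
    funext r
    simpa [Matrix.mulVec, dotProduct, Fin.sum_univ_four] using h r
  have odd_cast : ∀ w : Fin 4 → ℤ, Odd (w 0 + w 1 + w 2 + w 3) →
      (w 3 : ZMod 2) = 1 + w 0 + w 1 + w 2 := by
    intro w hw
    have h := (ZMod.intCast_eq_one_iff_odd).2 hw
    push_cast at h
    generalize (w 0 : ZMod 2) = a₀ at *
    generalize (w 1 : ZMod 2) = a₁ at *
    generalize (w 2 : ZMod 2) = a₂ at *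
    generalize (w 3 : ZMod 2) = a₃ at *
    revert a₀ a₁ a₂ a₃
    decide
  have hp3 := odd_cast p hp
  have hq3 := odd_cast q hq
  have hu3 := odd_cast u hu
  have hv3 := odd_cast v hv
  have h_two : (2 : ZMod 2) = 0 := rfl
  refine ⟨fun h => ?_, fun h => ?_, fun h => ?_⟩
  · have h0 : (p 0 : ZMod 2) + q 0 = 0 := congrFun h 0
    have h1 : (p 1 : ZMod 2) + q 1 = 0 := congrFun h 1
    have h2 : (p 2 : ZMod 2) + q 2 = 0 := congrFun h 2
    have h3 : (p 3 : ZMod 2) + q 3 = 0 := by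
      rw [hp3, hq3]; linear_combination h0 + h1 + h2 + h_two
    obtain ⟨r, hr⟩ := h_ker ![1, 1, 0, 0] (by decide)
    fin_cases r <;> simp_all
  · have h0 : (u 0 : ZMod 2) + v 0 = 0 := congrFun h 0
    have h1 : (u 1 : ZMod 2) + v 1 = 0 := congrFun h 1
    have h2 : (u 2 : ZMod 2) + v 2 = 0 := congrFun h 2
    have h3 : (u 3 : ZMod 2) + v 3 = 0 := by
      rw [hu3, hv3]; linear_combination h0 + h1 + h2 + h_two
    obtain ⟨r, hr⟩ := h_ker ![0, 0, 1, 1] (by decide)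
    fin_cases r <;> simp_all
  · have h0 : (p 0 : ZMod 2) + q 0 = u 0 + v 0 := congrFun h 0
    have h1 : (p 1 : ZMod 2) + q 1 = u 1 + v 1 := congrFun h 1
    have h2 : (p 2 : ZMod 2) + q 2 = u 2 + v 2 := congrFun h 2
    have h3 : (p 3 : ZMod 2) + q 3 = u 3 + v 3 := by
      rw [hp3, hq3, hu3, hv3]; linear_combination h0 + h1 + h2
    obtain ⟨r, hr⟩ := h_ker ![1, 1, 1, 1] (by decide)
    have h_all : ∀ r, (p r : ZMod 2) + q r = u r + v r := by
      intro r
      fin_cases r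
      exacts [h0, h1, h2, h3]
    apply hr
    change (p r : ZMod 2) * 1 + q r * 1 + u r * 1 + v r * 1 = 0
    linear_combination h_all r + (u r + v r : ZMod 2) * h_two

/-- For odd `m₁ = 2s+1`, `m₂ = 2t+1` with `s, t ≥ 2`, there is no
refined characteristic matrix over `C₂(m₁) × C₂(m₂)` (columns indexed by
`ZMod m₁ ⊕ ZMod m₂`, vertices corresponding to cyclically adjacent pairs in each factor)
with all column sums odd (the spin condition). -/
theorem stmt_14 (s t : ℕ) (hs : 2 ≤ s) (ht : 2 ≤ t) :
    ¬ ∃ lam : Fin 4 → (ZMod (2 * s + 1) ⊕ ZMod (2 * t + 1)) → ℤ,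
      (∀ r : Fin 4, lam r (Sum.inl 1) = if r = 0 then 1 else 0) ∧
      (∀ r : Fin 4, lam r (Sum.inl 2) = if r = 1 then 1 else 0) ∧
      (∀ r : Fin 4, lam r (Sum.inr 1) = if r = 2 then 1 else 0) ∧
      (∀ r : Fin 4, lam r (Sum.inr 2) = if r = 3 then 1 else 0) ∧
      (∀ (i : ZMod (2 * s + 1)) (j : ZMod (2 * t + 1)),
        (Matrix.of fun (r c : Fin 4) =>
            ![lam r (Sum.inl i), lam r (Sum.inl (i + 1)),
              lam r (Sum.inr j), lam r (Sum.inr (j + 1))] c).det = 1 ∨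
        (Matrix.of fun (r c : Fin 4) =>
            ![lam r (Sum.inl i), lam r (Sum.inl (i + 1)),
              lam r (Sum.inr j), lam r (Sum.inr (j + 1))] c).det = -1) ∧
      (∀ c : ZMod (2 * s + 1) ⊕ ZMod (2 * t + 1),
        Odd (lam 0 c + lam 1 c + lam 2 c + lam 3 c)) := by
  rintro ⟨lam, -, -, -, -, h_det, h_odd⟩
  have key := fun i j => column_sums_of_det_eq_one_or_neg_one
    (fun r => lam r (Sum.inl i)) (fun r => lam r (Sum.inl (i + 1)))
    (fun r => lam r (Sum.inr j)) (fun r => lam r (Sum.inr (j + 1)))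
    (h_det i j) (h_odd _) (h_odd _) (h_odd _) (h_odd _)
  obtain ⟨i, j, hij⟩ := exists_common_step s t
    (fun i k => (lam k.castSucc (Sum.inl i) : ZMod 2))
    (fun j k => (lam k.castSucc (Sum.inr j) : ZMod 2))
    (fun i => (key i 0).1) (fun j => (key 0 j).2.1)
  exact (key i j).2.2 hij
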